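/- Let J ⊆ S and x ∈ W. If y ∈ W^J then x ▷ y ∈ W^J, and if z ∈ ^J W then z ◁ x ∈ ^J W. -/

import Mathlib

/-! Common setup: a finite Coxeter system, Bruhat order, and the sets
`{u * y : u ≤ x}` and `{x * v : v ≤ y}` used to characterize the
Demazure product `∗` and the operations `▷`, `◁`. -/

/-- The Bruhat order on a Coxeter group: the reflexive-transitive closure of
the relation `u → u * t`, where `t` is a reflection and right multiplication
by `t` increases length. -/
def CoxeterSystem.bruhatLE {B W : Type*} [Group W] {M : CoxeterMatrix B}
    (cs : CoxeterSystem M W) : W → W → Prop :=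
  Relation.ReflTransGen
    (fun u v => ∃ t, cs.IsReflection t ∧ v = u * t ∧ cs.length u < cs.length v)

/-- The set `{u * y : u ∈ W, u ≤ x}`. -/
def CoxeterSystem.lset {B W : Type*} [Group W] {M : CoxeterMatrix B}
    (cs : CoxeterSystem M W) (x y : W) : Set W :=
  {z | ∃ u, cs.bruhatLE u x ∧ z = u * y}

/-- The set `{x * v : v ∈ W, v ≤ y}`. -/
def CoxeterSystem.rset {B W : Type*} [Group W] {M : CoxeterMatrix B}
    (cs : CoxeterSystem M W) (x y : W) : Set W :=
  {z | ∃ v, cs.bruhatLE v y ∧ z = x * v}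

namespace CoxeterSystem

variable {B W : Type*} [Group W] {M : CoxeterMatrix B} (cs : CoxeterSystem M W)

open Classical in
/-- The action of a simple reflection on signed group elements: conjugation, with the sign
changing exactly at the simple reflection itself. -/
noncomputable def signedConj (i : B) : Function.End (W × ZMod 2) :=
  fun p => (cs.simple i * p.1 * cs.simple i, p.2 + if p.1 = cs.simple i then 1 else 0)

open Classical in
theorem prod_map_signedConj_apply (ω : List B) (t : W) (e : ZMod 2) :
    (ω.map cs.signedConj).prod (t, e) =
      (cs.wordProd ω * t * (cs.wordProd ω)⁻¹, e + ((cs.rightInvSeq ω).count t : ZMod 2)) := by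
  induction ω with
  | nil => simp [Function.End.one_def]
  | cons i ω ih =>
    rw [List.map_cons, List.prod_cons]
    change cs.signedConj i ((ω.map cs.signedConj).prod (t, e)) = _
    rw [ih]
    have h : cs.wordProd ω * t * (cs.wordProd ω)⁻¹ = cs.simple i ↔
        (cs.wordProd ω)⁻¹ * cs.simple i * cs.wordProd ω = t := by
      constructor
      · intro h
        rw [← h]
        group
      · rintro rfl
        group
    simp [signedConj, rightInvSeq, wordProd_cons, List.count_cons, add_assoc, h]
    simp [mul_assoc]

theorem prod_map_signedConj_reverse_alternatingWord (i i' : B) (m : ℕ) :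
    ((alternatingWord i' i (2 * m)).reverse.map cs.signedConj).prod =
      (cs.signedConj i * cs.signedConj i') ^ m := by
  induction m with
  | zero => simp [alternatingWord]
  | succ m ih =>
    rw [Nat.mul_succ, alternatingWord_succ, alternatingWord_succ, pow_succ', ← ih]
    simp [mul_assoc]

open Classical in
theorem even_count_leftInvSeq_alternatingWord (i i' : B) (t : W) :
    Even ((cs.leftInvSeq (alternatingWord i i' (2 * M i i'))).count t) := by
  set L := cs.leftInvSeq (alternatingWord i i' (2 * M i i')) with hL
  have hlen : L.length = 2 * M i i' := by simp [hL]
  have h : L.take (M i i') = L.drop (M i i') := by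
    apply List.ext_getElem
    · simp only [List.length_take, List.length_drop]
      lia
    · intro k h₁ h₂
      have hk : k < M i i' := by
        simp only [List.length_take] at h₁
        lia
      rw [List.getElem_take, List.getElem_drop]
      simp only [hL]
      rw [cs.getElem_leftInvSeq_alternatingWord i i' _ k (by lia),
        cs.getElem_leftInvSeq_alternatingWord i i' _ (M i i' + k) (by lia),
        prod_alternatingWord_eq_mul_pow, prod_alternatingWord_eq_mul_pow,
        show (2 * k + 1) / 2 = k by lia, show (2 * (M i i' + k) + 1) / 2 = M i i' + k by lia,
        pow_add, simple_mul_simple_pow']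
      simp
  rw [← List.take_append_drop (M i i') L, ← h, List.count_append]
  exact ⟨_, rfl⟩

theorem isLiftable_signedConj : M.IsLiftable cs.signedConj := by
  classical
  intro i i'
  funext ⟨t, e⟩
  have h := cs.even_count_leftInvSeq_alternatingWord i' i t
  have hw : cs.wordProd (alternatingWord i' i (2 * M i' i)) = 1 := by
    rw [prod_alternatingWord_eq_mul_pow, if_pos (even_two_mul _),
      Nat.mul_div_cancel_left _ two_pos, simple_mul_simple_pow, one_mul]
  rw [← prod_map_signedConj_reverse_alternatingWord, prod_map_signedConj_apply,
    rightInvSeq_reverse, List.count_reverse, wordProd_reverse, M.symmetric i i', hw,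
    (ZMod.natCast_eq_zero_iff_even).mpr h]
  simp [Function.End.one_def]

/-- The parity of the number of occurrences of `t` in the right inversion sequence of any word
for `w`. -/
noncomputable def inversionParity (w t : W) : ZMod 2 :=
  (cs.lift ⟨cs.signedConj, cs.isLiftable_signedConj⟩ w (t, 0)).2

theorem lift_signedConj_wordProd (ω : List B) :
    cs.lift ⟨cs.signedConj, cs.isLiftable_signedConj⟩ (cs.wordProd ω) =
      (ω.map cs.signedConj).prod := by
  simp [wordProd, map_list_prod, Function.comp_def, lift_apply_simple]

open Classical in
theorem inversionParity_wordProd (ω : List B) (t : W) :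
    cs.inversionParity (cs.wordProd ω) t = (cs.rightInvSeq ω).count t := by
  rw [inversionParity, lift_signedConj_wordProd, prod_map_signedConj_apply, zero_add]

theorem inversionParity_mul (u w t : W) :
    cs.inversionParity (u * w) t =
      cs.inversionParity w t + cs.inversionParity u (w * t * w⁻¹) := by
  classical
  obtain ⟨ω, -, rfl⟩ := cs.exists_isReduced w
  obtain ⟨υ, -, rfl⟩ := cs.exists_isReduced u
  rw [inversionParity_wordProd, inversionParity_wordProd, inversionParity, map_mul,
    lift_signedConj_wordProd, lift_signedConj_wordProd]
  change ((υ.map cs.signedConj).prod ((ω.map cs.signedConj).prod (t, 0))).2 = _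
  rw [prod_map_signedConj_apply, prod_map_signedConj_apply, zero_add]

theorem isRightInversion_of_inversionParity_ne_zero {w t : W}
    (h : cs.inversionParity w t ≠ 0) : cs.IsRightInversion w t := by
  classical
  obtain ⟨ω, hω, rfl⟩ := cs.exists_isReduced w
  rw [inversionParity_wordProd] at h
  refine cs.isRightInversion_of_mem_rightInvSeq hω ?_
  by_contra ht
  simp [List.count_eq_zero_of_not_mem ht] at h

theorem inversionParity_simple_self (i : B) :
    cs.inversionParity (cs.simple i) (cs.simple i) = 1 := by
  classical
  rw [← wordProd_singleton, inversionParity_wordProd]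
  simp

theorem inversionParity_simple_eq_zero {w : W} {i : B}
    (h : cs.length w < cs.length (w * cs.simple i)) :
    cs.inversionParity w (cs.simple i) = 0 := by
  by_contra hne
  exact absurd (cs.isRightInversion_of_inversionParity_ne_zero hne).2 h.le.not_gt

theorem inversionParity_simple_ne_zero {w : W} {i : B}
    (h : cs.length (w * cs.simple i) < cs.length w) :
    cs.inversionParity w (cs.simple i) ≠ 0 := by
  have h₁ := cs.inversionParity_mul (w * cs.simple i) (cs.simple i) (cs.simple i)
  have h₂ : cs.inversionParity (w * cs.simple i) (cs.simple i) = 0 :=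
    cs.inversionParity_simple_eq_zero (by simpa using h)
  simp only [simple_mul_simple_cancel_right, inversionParity_simple_self, mul_inv_cancel_right,
    h₂, add_zero] at h₁
  rw [h₁]
  exact one_ne_zero

/-- If `i` is a right descent of `u * y` but not of `y`, then the reflection `y sᵢ y⁻¹` is a
right inversion of `u`. -/
theorem isRightInversion_conj_simple {u y : W} {i : B}
    (hy : cs.length y < cs.length (y * cs.simple i))
    (huy : cs.length (u * y * cs.simple i) < cs.length (u * y)) :
    cs.IsRightInversion u (y * cs.simple i * y⁻¹) := by
  apply cs.isRightInversion_of_inversionParity_ne_zero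
  have h := cs.inversionParity_simple_ne_zero huy
  rwa [inversionParity_mul, cs.inversionParity_simple_eq_zero hy, zero_add] at h

variable {cs}

theorem bruhatLE.length_le {u v : W} (h : cs.bruhatLE u v) : cs.length u ≤ cs.length v := by
  induction h with
  | refl => exact le_rfl
  | tail _ h ih =>
    obtain ⟨t, -, -, hlt⟩ := h
    exact ih.trans hlt.le

theorem IsRightInversion.bruhatLE {u t : W} (h : cs.IsRightInversion u t) :
    cs.bruhatLE (u * t) u :=
  .single ⟨t, h.1, by rw [mul_assoc, h.1.mul_self, mul_one], h.2⟩

theorem IsLeftInversion.bruhatLE {u t : W} (h : cs.IsLeftInversion u t) :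
    cs.bruhatLE (t * u) u := by
  have ht : cs.IsReflection (u⁻¹ * t * u) := by simpa using h.1.conj u⁻¹
  refine .single ⟨_, ht, ?_, h.2⟩
  rw [show t * u * (u⁻¹ * t * u) = t * t * u by group, h.1.mul_self, one_mul]

end CoxeterSystem

/-- Let `J ⊆ S` (a set of simple reflections) and `x ∈ W`. If `y ∈ W^J`
(i.e. `l(ys) > l(y)` for all `s ∈ J`) then `x ▷ y ∈ W^J`; and if `z ∈ ᴶW`
(i.e. `z⁻¹ ∈ W^J`) then `z ◁ x ∈ ᴶW`. -/
theorem rtr_ltr_minimal_coset_reps {B W : Type*} [Group W] [Finite W] {M : CoxeterMatrix B}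
    (cs : CoxeterSystem M W) (rtr ltr : W → W → W)
    (hrtr : ∀ x y : W, rtr x y ∈ cs.lset x y ∧
      ∀ z ∈ cs.lset x y, cs.bruhatLE (rtr x y) z)
    (hltr : ∀ x y : W, ltr x y ∈ cs.rset x y ∧
      ∀ z ∈ cs.rset x y, cs.bruhatLE (ltr x y) z)
    (J : Set W) (hJ : J ⊆ Set.range cs.simple) (x : W) :
    (∀ y : W, (∀ s ∈ J, cs.length y < cs.length (y * s)) →
      ∀ s ∈ J, cs.length (rtr x y) < cs.length (rtr x y * s)) ∧
    (∀ z : W, (∀ s ∈ J, cs.length z⁻¹ < cs.length (z⁻¹ * s)) →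
      ∀ s ∈ J, cs.length (ltr z x)⁻¹ < cs.length ((ltr z x)⁻¹ * s)) := by
  constructor
  · intro y hy s hs
    obtain ⟨i, rfl⟩ := hJ hs
    obtain ⟨⟨u, hu, heq⟩, hmin⟩ := hrtr x y
    refine ((cs.length_mul_simple_ne _ i).lt_or_gt).resolve_left fun hlt => ?_
    rw [heq] at hlt hmin
    have h := (cs.isRightInversion_conj_simple (hy _ hs) hlt).bruhatLE
    have hle := (hmin (u * y * cs.simple i) ⟨_, h.trans hu, by group⟩).length_le
    exact hle.not_gt hlt
  · intro z hz s hs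
    obtain ⟨i, rfl⟩ := hJ hs
    obtain ⟨⟨v, hv, heq⟩, hmin⟩ := hltr z x
    refine ((cs.length_mul_simple_ne _ i).lt_or_gt).resolve_left fun hlt => ?_
    rw [heq] at hmin
    rw [heq, mul_inv_rev] at hlt
    have h := (cs.isRightInversion_inv_iff.mp
      (cs.isRightInversion_conj_simple (hz _ hs) hlt)).bruhatLE
    have hle := (hmin (cs.simple i * (z * v)) ⟨_, h.trans hv, by group⟩).length_le
    rw [← cs.length_inv (z * v), ← cs.length_inv (cs.simple i * (z * v))] at hle
    simp only [mul_inv_rev, cs.inv_simple] at hle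
    exact hle.not_gt hlt
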